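/- Assume d ≥ 3 and let r = diag(−1,−1,−1,−1,1,…,1) ∈ O(β) (negating the coordinates x₀,x₁,x₂,x₃). Then r ∈ G^h, r does not lie in the identity component G^h_e of G^h (with the subspace topology), and G^h = G^h_e ∪ r·G^h_e; in particular G^h has exactly two connected components. -/

import Mathlib

noncomputable section

/-- `V = ℝ^{d+1}`. -/
abbrev Vd (d : ℕ) : Type := Fin (d + 1) → ℝ

/-- The symmetric bilinear form `β(x,y) = x₀y₀ + x₁y₁ − x₂y₂ − ⋯ − x_dy_d`. -/
def betaB (d : ℕ) (x y : Vd d) : ℝ :=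
  ∑ j : Fin (d + 1), (if (j : ℕ) ≤ 1 then (1 : ℝ) else -1) * x j * y j

abbrev Mat (d : ℕ) : Type := Matrix (Fin (d + 1)) (Fin (d + 1)) ℝ

/-- The group `O(β)` of linear automorphisms of `V` preserving `β`,
as a set of matrices (with the subspace topology of `End(V)`). -/
def Obeta (d : ℕ) : Set (Mat d) :=
  {g | IsUnit g ∧ ∀ x y : Vd d, betaB d (g.mulVec x) (g.mulVec y) = betaB d x y}

/-- `G = SO_{2,d-1}(ℝ)_e`, the identity component of `O(β)`. -/
def Gset (d : ℕ) : Set (Mat d) := connectedComponentIn (Obeta d) 1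

/-- Anti-de Sitter space `AdS^d = {x : β(x,x) = 1}`. -/
def AdS (d : ℕ) : Set (Vd d) := {x | betaB d x x = 1}

/-- Standard basis vector `e_i`. -/
def evec (d : ℕ) (i : Fin (d + 1)) : Vd d := fun j => if j = i then 1 else 0

/-- The positive causal cone `V₊(e₀)` at the base point. -/
def Vplus (d : ℕ) : Set (Vd d) :=
  {v | betaB d (evec d 0) v = 0 ∧ 0 < betaB d v v ∧ 0 < betaB d v (evec d 1)}

/-- A pair `(x,y)` with `x ∈ M`, `β(x,y) = 0` is positive if some `g ∈ G`
moves it into the positive cone at the base point. -/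
def posPair (d : ℕ) (x y : Vd d) : Prop :=
  ∃ g ∈ Gset d, g.mulVec x = evec d 0 ∧ g.mulVec y ∈ Vplus d

/-- Representing `z = x + iy ∈ V_ℂ` as the pair `(x,y)`: the set
`M_ℂ ∩ (V + i V_{>0})`. -/
def TubeSrc (d : ℕ) : Set (Vd d × Vd d) :=
  {p | betaB d p.1 p.1 - betaB d p.2 p.2 = 1 ∧ betaB d p.1 p.2 = 0 ∧ 0 < betaB d p.2 p.2}

/-- The positive tube domain `𝒯_M⁺`: those `z = x + iy` in `M_ℂ ∩ 𝒯_V` for which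
`Γ(z) = β(x,x)^{-1/2}(x,y)` is a positive pair. -/
def TubePlus (d : ℕ) : Set (Vd d × Vd d) :=
  {p | p ∈ TubeSrc d ∧
    posPair d ((Real.sqrt (betaB d p.1 p.1))⁻¹ • p.1) ((Real.sqrt (betaB d p.1 p.1))⁻¹ • p.2)}

/-- The involution `τ_h = diag(1,−1,−1,1,…,1)`. -/
def tauh (d : ℕ) : Mat d :=
  Matrix.diagonal fun j : Fin (d + 1) => if (j : ℕ) = 1 ∨ (j : ℕ) = 2 then (-1 : ℝ) else 1

/-- The Euler element `h` with `h e₁ = e₂`, `h e₂ = e₁`, `h e_j = 0` otherwise. -/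
def hmat (d : ℕ) : Mat d :=
  Matrix.of fun i j : Fin (d + 1) =>
    if ((i : ℕ) = 1 ∧ (j : ℕ) = 2) ∨ ((i : ℕ) = 2 ∧ (j : ℕ) = 1) then (1 : ℝ) else 0

/-- The centralizer `G^h = {g ∈ G : gh = hg}`. -/
def Gh (d : ℕ) : Set (Mat d) := {g ∈ Gset d | g * hmat d = hmat d * g}

/-- The positivity domain `W_M⁺(h) = {x ∈ M : (x, hx) is positive}`. -/
def WplusDom (d : ℕ) : Set (Vd d) := {x ∈ AdS d | posPair d x ((hmat d).mulVec x)}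

/-- `α_{it}(x) = (x₀, cos t·x₁ + i sin t·x₂, cos t·x₂ + i sin t·x₁, x₃, …, x_d)`,
written as a pair (real part, imaginary part). -/
def alphaIt (d : ℕ) (t : ℝ) (x : Vd d) : Vd d × Vd d :=
  (fun j => if (j : ℕ) = 1 ∨ (j : ℕ) = 2 then Real.cos t * x j else x j,
   fun j => if (j : ℕ) = 1 then Real.sin t * x 2
            else if (j : ℕ) = 2 then Real.sin t * x 1 else 0)

/-- The KMS wedge domain `W_M^{KMS}(h)`. -/
def KMSdom (d : ℕ) : Set (Vd d) :=
  {x ∈ AdS d | ∀ t : ℝ, 0 < t → t < Real.pi → alphaIt d t x ∈ TubePlus d}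

/-- `r = diag(−1,−1,−1,−1,1,…,1)`. -/
def rmat (d : ℕ) : Mat d :=
  Matrix.diagonal fun j : Fin (d + 1) => if (j : ℕ) ≤ 3 then (-1 : ℝ) else 1

/-! ### The bilinear form -/

lemma betaB_comm (d : ℕ) (x y : Vd d) : betaB d x y = betaB d y x := by
  unfold betaB
  exact Finset.sum_congr rfl fun j _ => by ring

lemma betaB_add_left (d : ℕ) (x y z : Vd d) :
    betaB d (x + y) z = betaB d x z + betaB d y z := by
  unfold betaB
  rw [← Finset.sum_add_distrib]
  exact Finset.sum_congr rfl fun j _ => by simp only [Pi.add_apply]; ring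

lemma betaB_smul_left (d : ℕ) (c : ℝ) (x z : Vd d) :
    betaB d (c • x) z = c * betaB d x z := by
  unfold betaB
  rw [Finset.mul_sum]
  exact Finset.sum_congr rfl fun j _ => by simp only [Pi.smul_apply, smul_eq_mul]; ring

lemma betaB_sub_left (d : ℕ) (x y z : Vd d) :
    betaB d (x - y) z = betaB d x z - betaB d y z := by
  unfold betaB
  rw [← Finset.sum_sub_distrib]
  exact Finset.sum_congr rfl fun j _ => by simp only [Pi.sub_apply]; ring

lemma betaB_add_right (d : ℕ) (x y z : Vd d) :
    betaB d z (x + y) = betaB d z x + betaB d z y := by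
  simp only [betaB_comm d z, betaB_add_left]

lemma betaB_smul_right (d : ℕ) (c : ℝ) (x z : Vd d) :
    betaB d z (c • x) = c * betaB d z x := by
  simp only [betaB_comm d z, betaB_smul_left]

lemma betaB_sub_right (d : ℕ) (x y z : Vd d) :
    betaB d z (x - y) = betaB d z x - betaB d z y := by
  simp only [betaB_comm d z, betaB_sub_left]

lemma betaB_evec_left (d : ℕ) (i : Fin (d + 1)) (x : Vd d) :
    betaB d (evec d i) x = (if (i : ℕ) ≤ 1 then (1 : ℝ) else -1) * x i := by
  unfold betaB evec
  rw [Finset.sum_eq_single i]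
  · simp
  · intro j _ hj
    simp [hj]
  · simp

lemma betaB_self_nonpos (d : ℕ) (w : Vd d) (hw : ∀ j : Fin (d + 1), (j : ℕ) ≤ 1 → w j = 0) :
    betaB d w w ≤ 0 := by
  unfold betaB
  refine Finset.sum_nonpos fun j _ => ?_
  by_cases hj : (j : ℕ) ≤ 1
  · simp [hw j hj]
  · simp only [hj, if_false]
    nlinarith [mul_self_nonneg (w j)]

lemma betaB_self_neg (d : ℕ) (w : Vd d) (hw : ∀ j : Fin (d + 1), (j : ℕ) ≤ 1 → w j = 0)
    (h0 : w ≠ 0) : betaB d w w < 0 := by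
  refine lt_of_le_of_ne (betaB_self_nonpos d w hw) fun h => h0 ?_
  unfold betaB at h
  rw [Finset.sum_eq_zero_iff_of_nonpos] at h
  · ext j
    by_cases hj : (j : ℕ) ≤ 1
    · exact hw j hj
    · have := h j (Finset.mem_univ j)
      simpa [hj] using this
  · intro j _
    by_cases hj : (j : ℕ) ≤ 1
    · simp [hw j hj]
    · simp only [hj, if_false]
      nlinarith [mul_self_nonneg (w j)]

lemma continuous_betaB_self (d : ℕ) : Continuous fun w : Vd d => betaB d w w := by
  unfold betaB
  fun_prop

lemma mulVec_evec (d : ℕ) (g : Mat d) (i : Fin (d + 1)) : g.mulVec (evec d i) = fun j => g j i := by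
  ext j
  simp [Matrix.mulVec, dotProduct, evec]

lemma evec_apply_self (d : ℕ) (i : Fin (d + 1)) : evec d i i = 1 := by simp [evec]

lemma evec_apply_ne (d : ℕ) {i j : Fin (d + 1)} (h : j ≠ i) : evec d i j = 0 := by simp [evec, h]

lemma mat_ext_mulVec (d : ℕ) {g k : Mat d} (h : ∀ x, g.mulVec x = k.mulVec x) : g = k := by
  ext i j
  have := congrFun (h (evec d j)) i
  simpa only [mulVec_evec] using this

/-! ### Reflections -/

/-- The `β`-orthogonal reflection in the hyperplane orthogonal to `w`. -/
def betaReflection (d : ℕ) (w : Vd d) : Mat d :=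
  1 - (2 / betaB d w w) •
    Matrix.vecMulVec w (fun j : Fin (d + 1) => (if (j : ℕ) ≤ 1 then (1 : ℝ) else -1) * w j)

lemma betaReflection_mulVec (d : ℕ) (w x : Vd d) :
    (betaReflection d w).mulVec x = x - (2 * betaB d w x / betaB d w w) • w := by
  ext i
  have : ∑ j : Fin (d + 1), w i * ((if (j : ℕ) ≤ 1 then (1 : ℝ) else -1) * w j) * x j
      = w i * betaB d w x := by
    unfold betaB
    rw [Finset.mul_sum]
    exact Finset.sum_congr rfl fun j _ => by ring
  simp only [betaReflection, Matrix.sub_mulVec, Matrix.one_mulVec, Matrix.smul_mulVec,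
    Pi.sub_apply, Pi.smul_apply, smul_eq_mul]
  simp only [Matrix.mulVec, dotProduct, Matrix.vecMulVec_apply, this]
  ring

lemma betaReflection_mul_self (d : ℕ) (w : Vd d) (hw : betaB d w w ≠ 0) :
    betaReflection d w * betaReflection d w = 1 := by
  apply mat_ext_mulVec
  intro x
  rw [← Matrix.mulVec_mulVec, Matrix.one_mulVec]
  simp only [betaReflection_mulVec, betaB_sub_right, betaB_smul_right]
  ext i
  simp only [Pi.sub_apply, Pi.smul_apply, smul_eq_mul]
  field_simp
  ring

lemma betaReflection_mem_Obeta (d : ℕ) (w : Vd d) (hw : betaB d w w ≠ 0) :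
    betaReflection d w ∈ Obeta d := by
  refine ⟨IsUnit.of_mul_eq_one _ (betaReflection_mul_self d w hw), fun x y => ?_⟩
  simp only [betaReflection_mulVec, betaB_sub_right, betaB_smul_right, betaB_sub_left,
    betaB_smul_left]
  rw [betaB_comm d x w]
  field_simp
  ring

lemma betaReflection_neg (d : ℕ) (w : Vd d) : betaReflection d (-w) = betaReflection d w := by
  apply mat_ext_mulVec
  intro x
  simp only [betaReflection_mulVec, ← neg_one_smul ℝ w, betaB_smul_left, betaB_smul_right]
  ext i
  simp only [Pi.sub_apply, Pi.smul_apply, smul_eq_mul]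
  ring

lemma betaReflection_evec (d : ℕ) (i : Fin (d + 1)) :
    betaReflection d (evec d i) = Matrix.diagonal fun j => if j = i then (-1 : ℝ) else 1 := by
  apply mat_ext_mulVec
  intro x
  ext j
  rw [betaReflection_mulVec, Matrix.mulVec_diagonal]
  simp only [betaB_evec_left, Pi.sub_apply, Pi.smul_apply, smul_eq_mul, evec]
  by_cases hj : j = i <;> by_cases hi : (i : ℕ) ≤ 1 <;> simp [hj, hi] <;> ring

/-! ### Components of matrix monoids -/

lemma mul_mem_component (d : ℕ) {S : Set (Mat d)} (hS : ∀ a ∈ S, ∀ b ∈ S, a * b ∈ S)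
    {a b : Mat d} (ha : a ∈ connectedComponentIn S 1) (hb : b ∈ connectedComponentIn S 1) :
    a * b ∈ connectedComponentIn S 1 := by
  have h1 : (1 : Mat d) ∈ S := by
    by_contra h
    simp [connectedComponentIn_eq_empty h] at ha
  have hc : IsPreconnected ((fun g => g * b) '' connectedComponentIn S 1) :=
    isPreconnected_connectedComponentIn.image _ (by fun_prop)
  have hsub : (fun g => g * b) '' connectedComponentIn S 1 ⊆ S := by
    rintro _ ⟨g, hg, rfl⟩
    exact hS _ (connectedComponentIn_subset S 1 hg) _ (connectedComponentIn_subset S 1 hb)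
  have := hc.subset_connectedComponentIn ⟨1, mem_connectedComponentIn h1, one_mul b⟩ hsub
  rw [connectedComponentIn_eq hb]
  exact this ⟨a, ha, rfl⟩

lemma reflection_mul_reflection_mem_component (d : ℕ) {S : Set (Mat d)}
    (hS : ∀ a ∈ S, ∀ b ∈ S, a * b ∈ S) (u v : Vd d)
    (hn : ∀ t ∈ Set.Icc (0 : ℝ) 1, betaB d ((1 - t) • u + t • v) ((1 - t) • u + t • v) ≠ 0)
    (hm : ∀ t ∈ Set.Icc (0 : ℝ) 1, betaReflection d ((1 - t) • u + t • v) ∈ S) :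
    betaReflection d u * betaReflection d v ∈ connectedComponentIn S 1 := by
  have hv : betaB d v v ≠ 0 := by simpa using hn 1 (by simp)
  have hvS : betaReflection d v ∈ S := by simpa using hm 1 (by simp)
  have hcont : ContinuousOn
      (fun t : ℝ => betaReflection d ((1 - t) • u + t • v) * betaReflection d v)
      (Set.Icc 0 1) := by
    have hw : Continuous fun t : ℝ => (1 - t) • u + t • v := by fun_prop
    have hc : ContinuousOn (fun t : ℝ =>
        2 / betaB d ((1 - t) • u + t • v) ((1 - t) • u + t • v)) (Set.Icc 0 1) :=
      continuousOn_const.div ((continuous_betaB_self d).comp hw).continuousOn hn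
    have hm : Continuous fun t : ℝ => Matrix.vecMulVec ((1 - t) • u + t • v)
        (fun j : Fin (d + 1) => (if (j : ℕ) ≤ 1 then (1 : ℝ) else -1) *
          ((1 - t) • u + t • v) j) :=
      hw.matrix_vecMulVec (by fun_prop)
    exact (continuousOn_const.sub (hc.smul hm.continuousOn)).mul continuousOn_const
  have hc := isPreconnected_Icc.image _ hcont
  refine hc.subset_connectedComponentIn ⟨1, by simp, ?_⟩ ?_ ⟨0, by simp, by simp⟩
  · simpa using betaReflection_mul_self d v hv
  · rintro _ ⟨t, ht, rfl⟩
    exact hS _ (hm t ht) _ hvS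

lemma pos_of_mem_component (d : ℕ) {S : Set (Mat d)} (f : Mat d → ℝ) (hf : Continuous f)
    (hne : ∀ g ∈ S, f g ≠ 0) (h1 : 0 < f 1) {g : Mat d} (hg : g ∈ connectedComponentIn S 1) :
    0 < f g := by
  have h1S : (1 : Mat d) ∈ S := by
    by_contra h
    simp [connectedComponentIn_eq_empty h] at hg
  by_contra hcon
  obtain ⟨k, hk, hk0⟩ := (isPreconnected_connectedComponentIn (F := S) (x := 1)).intermediate_value
    hg (mem_connectedComponentIn h1S) hf.continuousOn ⟨not_lt.mp hcon, h1.le⟩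
  exact hne k (connectedComponentIn_subset S 1 hk) hk0

/-! ### The orthogonal group and the centralizer of `h` -/

lemma one_mem_Obeta (d : ℕ) : (1 : Mat d) ∈ Obeta d :=
  ⟨isUnit_one, fun x y => by simp⟩

lemma mul_mem_Obeta (d : ℕ) : ∀ a ∈ Obeta d, ∀ b ∈ Obeta d, a * b ∈ Obeta d := by
  intro a ha b hb
  refine ⟨ha.1.mul hb.1, fun x y => ?_⟩
  rw [← Matrix.mulVec_mulVec, ← Matrix.mulVec_mulVec, ha.2, hb.2]

/-- The centralizer of `h` in the full group `O(β)`. -/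
def ObetaCentralizer (d : ℕ) : Set (Mat d) := {g ∈ Obeta d | g * hmat d = hmat d * g}

lemma one_mem_ObetaCentralizer (d : ℕ) : (1 : Mat d) ∈ ObetaCentralizer d :=
  ⟨one_mem_Obeta d, by simp⟩

lemma mul_mem_ObetaCentralizer (d : ℕ) :
    ∀ a ∈ ObetaCentralizer d, ∀ b ∈ ObetaCentralizer d, a * b ∈ ObetaCentralizer d := by
  intro a ha b hb
  refine ⟨mul_mem_Obeta d a ha.1 b hb.1, ?_⟩
  rw [mul_assoc, hb.2, ← mul_assoc, ha.2, mul_assoc]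

lemma Gh_subset_ObetaCentralizer (d : ℕ) : Gh d ⊆ ObetaCentralizer d :=
  fun _ hg => ⟨connectedComponentIn_subset _ _ hg.1, hg.2⟩

lemma component_ObetaCentralizer_subset (d : ℕ) :
    connectedComponentIn (ObetaCentralizer d) 1 ⊆ connectedComponentIn (Gh d) 1 := by
  have hc := isPreconnected_connectedComponentIn (F := ObetaCentralizer d) (x := 1)
  have h1 := mem_connectedComponentIn (one_mem_ObetaCentralizer d)
  refine hc.subset_connectedComponentIn h1 fun g hg => ⟨?_, ?_⟩
  · exact hc.subset_connectedComponentIn h1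
      (fun k hk => (connectedComponentIn_subset _ _ hk).1) hg
  · exact (connectedComponentIn_subset _ _ hg).2

lemma hmat_mulVec (d : ℕ) (hd : 3 ≤ d) (x : Vd d) (i : Fin (d + 1)) :
    (hmat d).mulVec x i = if (i : ℕ) = 1 then x ⟨2, by omega⟩
      else if (i : ℕ) = 2 then x ⟨1, by omega⟩ else 0 := by
  simp only [Matrix.mulVec, dotProduct, hmat, Matrix.of_apply]
  by_cases h1 : (i : ℕ) = 1
  · rw [Finset.sum_eq_single ⟨2, by omega⟩]
    · simp [h1]
    · intro j _ hj
      have : (j : ℕ) ≠ 2 := fun h => hj (Fin.ext h)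
      simp [h1, this]
    · simp
  · by_cases h2 : (i : ℕ) = 2
    · rw [Finset.sum_eq_single ⟨1, by omega⟩]
      · simp [h2]
      · intro j _ hj
        have : (j : ℕ) ≠ 1 := fun h => hj (Fin.ext h)
        simp [h2, this]
      · simp
    · simp [h1, h2]

lemma hmat_mulVec_evec (d : ℕ) (hd : 3 ≤ d) (k : Fin (d + 1)) (h1 : (k : ℕ) ≠ 1)
    (h2 : (k : ℕ) ≠ 2) : (hmat d).mulVec (evec d k) = 0 := by
  ext i
  rw [hmat_mulVec d hd, evec_apply_ne, evec_apply_ne]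
  · simp
  · exact fun h => h1 (by rw [← h])
  · exact fun h => h2 (by rw [← h])

lemma hmat_mulVec_evec_one (d : ℕ) (hd : 3 ≤ d) :
    (hmat d).mulVec (evec d ⟨1, by omega⟩) = evec d ⟨2, by omega⟩ := by
  ext i
  rw [hmat_mulVec d hd]
  simp only [evec, Fin.ext_iff]
  split_ifs <;> first | rfl | omega

lemma hmat_mulVec_evec_two (d : ℕ) (hd : 3 ≤ d) :
    (hmat d).mulVec (evec d ⟨2, by omega⟩) = evec d ⟨1, by omega⟩ := by
  ext i
  rw [hmat_mulVec d hd]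
  simp only [evec, Fin.ext_iff]
  split_ifs <;> first | rfl | omega

lemma hmat_commute_mulVec (d : ℕ) {g : Mat d} (hg : g * hmat d = hmat d * g) (x : Vd d) :
    (hmat d).mulVec (g.mulVec x) = g.mulVec ((hmat d).mulVec x) := by
  rw [Matrix.mulVec_mulVec, Matrix.mulVec_mulVec, hg]

/-- Columns other than `1, 2` of a matrix commuting with `h` vanish in rows `1, 2`. -/
lemma entries_of_commute (d : ℕ) (hd : 3 ≤ d) {g : Mat d} (hg : g * hmat d = hmat d * g)
    (k : Fin (d + 1)) (h1 : (k : ℕ) ≠ 1) (h2 : (k : ℕ) ≠ 2) :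
    g ⟨1, by omega⟩ k = 0 ∧ g ⟨2, by omega⟩ k = 0 := by
  have h := hmat_commute_mulVec d hg (evec d k)
  rw [hmat_mulVec_evec d hd k h1 h2, Matrix.mulVec_zero, mulVec_evec] at h
  have e1 := congrFun h ⟨1, by omega⟩
  have e2 := congrFun h ⟨2, by omega⟩
  rw [hmat_mulVec d hd] at e1 e2
  simp at e1 e2
  exact ⟨e2, e1⟩

/-- The `(1, 2)`-block of a matrix commuting with `h` is `!![a, b; b, a]`. -/
lemma block_of_commute (d : ℕ) (hd : 3 ≤ d) {g : Mat d} (hg : g * hmat d = hmat d * g) :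
    g.mulVec (evec d ⟨1, by omega⟩) = g ⟨1, by omega⟩ ⟨1, by omega⟩ • evec d ⟨1, by omega⟩
      + g ⟨2, by omega⟩ ⟨1, by omega⟩ • evec d ⟨2, by omega⟩ ∧
    g.mulVec (evec d ⟨2, by omega⟩) = g ⟨2, by omega⟩ ⟨1, by omega⟩ • evec d ⟨1, by omega⟩
      + g ⟨1, by omega⟩ ⟨1, by omega⟩ • evec d ⟨2, by omega⟩ := by
  have ha := hmat_commute_mulVec d hg (evec d ⟨1, by omega⟩)
  have hb := hmat_commute_mulVec d hg (evec d ⟨2, by omega⟩)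
  rw [hmat_mulVec_evec_one d hd] at ha
  rw [hmat_mulVec_evec_two d hd] at hb
  have e3 := congrFun ha ⟨2, by omega⟩
  have e4 := congrFun ha ⟨1, by omega⟩
  simp [mulVec_evec, hmat_mulVec d hd] at e3 e4
  rw [← ha, ← hb]
  constructor
  · ext i
    simp only [hmat_mulVec d hd, mulVec_evec, Pi.add_apply, Pi.smul_apply, smul_eq_mul, evec,
      Fin.ext_iff]
    split_ifs <;> first | omega | simp [e3, e4]
  · ext i
    simp only [hmat_mulVec d hd, mulVec_evec, Pi.add_apply, Pi.smul_apply, smul_eq_mul, evec,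
      Fin.ext_iff]
    split_ifs <;> first | omega | simp [e3, e4]

lemma block_sq (d : ℕ) (hd : 3 ≤ d) {g : Mat d} (hg : g ∈ ObetaCentralizer d) :
    g ⟨1, by omega⟩ ⟨1, by omega⟩ ^ 2 = 1 + g ⟨2, by omega⟩ ⟨1, by omega⟩ ^ 2 := by
  have h := hg.1.2 (evec d ⟨1, by omega⟩) (evec d ⟨1, by omega⟩)
  rw [(block_of_commute d hd hg.2).1] at h
  simp [betaB_add_left, betaB_smul_left, betaB_evec_left, evec] at h
  linarith

lemma betaReflection_mem_centralizer (d : ℕ) (hd : 3 ≤ d) (w : Vd d) (hw : betaB d w w ≠ 0)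
    (h1 : w ⟨1, by omega⟩ = 0) (h2 : w ⟨2, by omega⟩ = 0) :
    betaReflection d w ∈ ObetaCentralizer d := by
  refine ⟨betaReflection_mem_Obeta d w hw, mat_ext_mulVec d fun x => ?_⟩
  have hw0 : (hmat d).mulVec w = 0 := by
    ext i
    rw [hmat_mulVec d hd, h1, h2]
    simp
  have hb : betaB d w ((hmat d).mulVec x) = 0 := by
    unfold betaB
    refine Finset.sum_eq_zero fun j _ => ?_
    rw [hmat_mulVec d hd]
    by_cases hj1 : (j : ℕ) = 1
    · rw [show j = ⟨1, by omega⟩ from Fin.ext hj1, h1]; simp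
    · by_cases hj2 : (j : ℕ) = 2
      · rw [show j = ⟨2, by omega⟩ from Fin.ext hj2, h2]; simp
      · simp [hj1, hj2]
  rw [← Matrix.mulVec_mulVec, ← Matrix.mulVec_mulVec, betaReflection_mulVec,
    betaReflection_mulVec, hb, Matrix.mulVec_sub, Matrix.mulVec_smul, hw0]
  simp

lemma spacelike_reflections_mem_of_nonpos (d : ℕ) (hd : 3 ≤ d) (u v : Vd d)
    (hu : betaB d u u < 0) (hv : betaB d v v < 0) (huv : betaB d u v ≤ 0)
    (hu1 : u ⟨1, by omega⟩ = 0) (hu2 : u ⟨2, by omega⟩ = 0)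
    (hv1 : v ⟨1, by omega⟩ = 0) (hv2 : v ⟨2, by omega⟩ = 0) :
    betaReflection d u * betaReflection d v ∈ connectedComponentIn (ObetaCentralizer d) 1 := by
  have hn : ∀ t ∈ Set.Icc (0 : ℝ) 1,
      betaB d ((1 - t) • u + t • v) ((1 - t) • u + t • v) ≠ 0 := by
    rintro t ⟨h0, h1⟩
    simp only [betaB_add_left, betaB_add_right, betaB_smul_left, betaB_smul_right]
    rw [betaB_comm d v u]
    apply ne_of_lt
    have h3 : t * (1 - t) * betaB d u v ≤ 0 :=
      mul_nonpos_of_nonneg_of_nonpos (mul_nonneg h0 (by linarith)) huv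
    rcases h0.eq_or_lt with rfl | h0
    · simpa using hu
    · have h4 : t ^ 2 * betaB d v v < 0 := mul_neg_of_pos_of_neg (by positivity) hv
      have h5 : (1 - t) ^ 2 * betaB d u u ≤ 0 :=
        mul_nonpos_of_nonneg_of_nonpos (by positivity) hu.le
      nlinarith
  refine reflection_mul_reflection_mem_component d (mul_mem_ObetaCentralizer d) u v hn ?_
  intro t ht
  exact betaReflection_mem_centralizer d hd _ (hn t ht) (by simp [hu1, hv1]) (by simp [hu2, hv2])

/-- All spacelike reflections centralizing `h` lie in one component. -/
lemma spacelike_reflections_mem (d : ℕ) (hd : 3 ≤ d) (u v : Vd d)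
    (hu : betaB d u u < 0) (hv : betaB d v v < 0)
    (hu1 : u ⟨1, by omega⟩ = 0) (hu2 : u ⟨2, by omega⟩ = 0)
    (hv1 : v ⟨1, by omega⟩ = 0) (hv2 : v ⟨2, by omega⟩ = 0) :
    betaReflection d u * betaReflection d v ∈ connectedComponentIn (ObetaCentralizer d) 1 := by
  rcases le_total (betaB d u v) 0 with h | h
  · exact spacelike_reflections_mem_of_nonpos d hd u v hu hv h hu1 hu2 hv1 hv2
  · rw [← betaReflection_neg d u]
    refine spacelike_reflections_mem_of_nonpos d hd (-u) v ?_ hv ?_ ?_ ?_ hv1 hv2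
    · simpa only [← neg_one_smul ℝ u, betaB_smul_left, betaB_smul_right, neg_mul, one_mul,
        neg_neg] using hu
    · rw [← neg_one_smul ℝ u, betaB_smul_left]; linarith
    · simp [hu1]
    · simp [hu2]

/-- `g` lies in the identity component of the centralizer, up to the reflection in `e₃`. -/
def InComponentUpToReflection (d : ℕ) (hd : 3 ≤ d) (g : Mat d) : Prop :=
  g ∈ connectedComponentIn (ObetaCentralizer d) 1 ∨
    betaReflection d (evec d ⟨3, by omega⟩) * g ∈ connectedComponentIn (ObetaCentralizer d) 1

lemma inComponentUpToReflection_of_mul (d : ℕ) (hd : 3 ≤ d) {g : Mat d} (w : Vd d)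
    (hw : betaB d w w < 0) (h1 : w ⟨1, by omega⟩ = 0) (h2 : w ⟨2, by omega⟩ = 0)
    (h : InComponentUpToReflection d hd (betaReflection d w * g)) :
    InComponentUpToReflection d hd g := by
  have he : betaB d (evec d ⟨3, by omega⟩) (evec d ⟨3, by omega⟩) < 0 := by
    simp [betaB_evec_left, evec]
  have he1 : evec d ⟨3, by omega⟩ ⟨1, by omega⟩ = 0 := by simp [evec]
  have he2 : evec d ⟨3, by omega⟩ ⟨2, by omega⟩ = 0 := by simp [evec]
  have hmul := @mul_mem_component d _ (mul_mem_ObetaCentralizer d)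
  have hww := betaReflection_mul_self d w hw.ne
  have hee := betaReflection_mul_self d _ he.ne
  rcases h with h | h
  · right
    have := hmul (spacelike_reflections_mem d hd _ w he hw he1 he2 h1 h2) h
    rwa [mul_assoc, ← mul_assoc (betaReflection d w), hww, one_mul] at this
  · left
    have := hmul (spacelike_reflections_mem d hd w _ hw he h1 h2 he1 he2) h
    rwa [mul_assoc, ← mul_assoc (betaReflection d (evec d _)) (betaReflection d (evec d _)), hee,
      one_mul, ← mul_assoc, hww, one_mul] at this

/-- The reflection in `g e_k - e_k` moves `g e_k` to `e_k` and keeps the basis vectors fixed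
by `g`. -/
lemma reflection_fixes (d : ℕ) {g : Mat d} (hg : g ∈ Obeta d) (k : Fin (d + 1))
    (hw : betaB d (g.mulVec (evec d k) - evec d k) (g.mulVec (evec d k) - evec d k) ≠ 0)
    (j : Fin (d + 1)) (hj : j = k ∨ g.mulVec (evec d j) = evec d j) :
    (betaReflection d (g.mulVec (evec d k) - evec d k) * g).mulVec (evec d j) = evec d j := by
  rw [← Matrix.mulVec_mulVec, betaReflection_mulVec]
  rcases hj with rfl | hj
  · have h2 : 2 * betaB d (g.mulVec (evec d j) - evec d j) (g.mulVec (evec d j))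
        = betaB d (g.mulVec (evec d j) - evec d j) (g.mulVec (evec d j) - evec d j) := by
      simp only [betaB_sub_left, betaB_sub_right, hg.2]
      rw [betaB_comm d (g.mulVec _)]
      ring
    rw [h2, div_self hw, one_smul]
    abel
  · have h0 : betaB d (g.mulVec (evec d k) - evec d k) (evec d j) = 0 := by
      rw [betaB_sub_left]
      conv_lhs => rw [← hj]
      rw [hg.2, hj, sub_self]
    rw [hj, h0]
    simp

lemma inComponentUpToReflection_of_fixes (d : ℕ) (hd : 3 ≤ d) (S : Finset (Fin (d + 1))) :
    ∀ g ∈ ObetaCentralizer d, (∀ j : Fin (d + 1), (j : ℕ) ≤ 2 → g.mulVec (evec d j) = evec d j) →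
      (∀ j ∉ S, g.mulVec (evec d j) = evec d j) → InComponentUpToReflection d hd g := by
  classical
  induction S using Finset.induction_on with
  | empty =>
    intro g _ _ h
    left
    have : g = 1 := by
      ext i j
      have hij := congrFun (h j (by simp)) i
      rw [mulVec_evec] at hij
      exact hij.trans (by rw [evec, Matrix.one_apply])
    rw [this]
    exact mem_connectedComponentIn (one_mem_ObetaCentralizer d)
  | insert k S _ ih =>
    intro g hg h2 hS
    by_cases hk : g.mulVec (evec d k) = evec d k
    · refine ih g hg h2 fun j hj => ?_
      by_cases hjk : j = k
      · rw [hjk, hk]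
      · exact hS j (by simp [hj, hjk])
    · have hk2 : ¬ (k : ℕ) ≤ 2 := fun h => hk (h2 k h)
      have hz : ∀ j : Fin (d + 1), (j : ℕ) ≤ 2 → (g.mulVec (evec d k) - evec d k) j = 0 := by
        intro j hj
        have hb := hg.1.2 (evec d j) (evec d k)
        rw [h2 j hj, betaB_evec_left, betaB_evec_left] at hb
        have : (if (j : ℕ) ≤ 1 then (1 : ℝ) else -1) ≠ 0 := by split_ifs <;> norm_num
        rw [Pi.sub_apply, mul_left_cancel₀ this hb, sub_self]
      have hw := betaB_self_neg d _ (fun j hj => hz j (by omega)) (sub_ne_zero.mpr hk)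
      refine inComponentUpToReflection_of_mul d hd _ hw (hz _ (by simp)) (hz _ (by simp)) ?_
      refine ih _ (mul_mem_ObetaCentralizer d _ (betaReflection_mem_centralizer d hd _ hw.ne
        (hz _ (by simp)) (hz _ (by simp))) _ hg) ?_ ?_
      · exact fun j hj => reflection_fixes d hg.1 k hw.ne j (Or.inr (h2 j hj))
      · intro j hj
        refine reflection_fixes d hg.1 k hw.ne j ?_
        by_cases hjk : j = k
        · exact Or.inl hjk
        · exact Or.inr (hS j (by simp [hj, hjk]))

lemma inComponentUpToReflection_of_boost_trivial (d : ℕ) (hd : 3 ≤ d) {g : Mat d}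
    (hg : g ∈ ObetaCentralizer d)
    (h1 : g.mulVec (evec d ⟨1, by omega⟩) = evec d ⟨1, by omega⟩)
    (h2 : g.mulVec (evec d ⟨2, by omega⟩) = evec d ⟨2, by omega⟩)
    (h0 : 0 < g 0 0) : InComponentUpToReflection d hd g := by
  have key : ∀ k ∈ ObetaCentralizer d, k.mulVec (evec d 0) = evec d 0 →
      k.mulVec (evec d ⟨1, by omega⟩) = evec d ⟨1, by omega⟩ →
      k.mulVec (evec d ⟨2, by omega⟩) = evec d ⟨2, by omega⟩ →
      InComponentUpToReflection d hd k := by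
    intro k hk e0 e1 e2
    refine inComponentUpToReflection_of_fixes d hd Finset.univ k hk ?_ (by simp)
    intro j hj
    have : (j : ℕ) = 0 ∨ (j : ℕ) = 1 ∨ (j : ℕ) = 2 := by omega
    rcases this with h | h | h
    · rwa [show j = 0 from Fin.ext h]
    · rwa [show j = ⟨1, by omega⟩ from Fin.ext h]
    · rwa [show j = ⟨2, by omega⟩ from Fin.ext h]
  by_cases hk : g.mulVec (evec d 0) = evec d 0
  · exact key g hg hk h1 h2
  · have hent := entries_of_commute d hd hg.2 0 (by simp) (by simp)
    have hv := hg.1.2 (evec d 0) (evec d 0)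
    have hvv : betaB d (evec d 0) (evec d 0) = 1 := by simp [betaB_evec_left, evec]
    have hve : betaB d (evec d 0) (g.mulVec (evec d 0)) = g 0 0 := by
      rw [betaB_evec_left, mulVec_evec]; simp
    rw [hvv] at hv
    have hz : ∀ j : Fin (d + 1), (j : ℕ) ≤ 1 →
        (g.mulVec (evec d 0) - g 0 0 • evec d 0) j = 0 := by
      intro j hj
      rw [mulVec_evec]
      have : (j : ℕ) = 0 ∨ (j : ℕ) = 1 := by omega
      rcases this with h | h
      · rw [show j = 0 from Fin.ext h]; simp [evec]
      · rw [show j = ⟨1, by omega⟩ from Fin.ext h]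
        simp [evec, hent.1, Fin.ext_iff]
    have hle := betaB_self_nonpos d _ hz
    have hw : betaB d (g.mulVec (evec d 0) - evec d 0) (g.mulVec (evec d 0) - evec d 0) < 0 := by
      simp only [betaB_sub_left, betaB_sub_right, betaB_smul_left, betaB_smul_right,
        betaB_comm d (g.mulVec (evec d 0)) (evec d 0), hv, hve, hvv] at hle ⊢
      have hge : 1 ≤ g 0 0 := by nlinarith
      rcases hge.eq_or_lt with h | h
      · rw [← h, one_smul] at hz
        have := betaB_self_neg d _ hz (sub_ne_zero.mpr hk)
        simpa only [betaB_sub_left, betaB_sub_right, betaB_smul_left, betaB_smul_right,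
          betaB_comm d (g.mulVec (evec d 0)) (evec d 0), hv, hve, hvv] using this
      · linarith
    have hw1 : (g.mulVec (evec d 0) - evec d 0) ⟨1, by omega⟩ = 0 := by
      rw [mulVec_evec]; simp [evec, hent.1, Fin.ext_iff]
    have hw2 : (g.mulVec (evec d 0) - evec d 0) ⟨2, by omega⟩ = 0 := by
      rw [mulVec_evec]; simp [evec, hent.2, Fin.ext_iff]
    refine inComponentUpToReflection_of_mul d hd _ hw hw1 hw2 ?_
    refine key _ (mul_mem_ObetaCentralizer d _
      (betaReflection_mem_centralizer d hd _ hw.ne hw1 hw2) _ hg) ?_ ?_ ?_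
    · exact reflection_fixes d hg.1 0 hw.ne _ (Or.inl rfl)
    · exact reflection_fixes d hg.1 0 hw.ne _ (Or.inr h1)
    · exact reflection_fixes d hg.1 0 hw.ne _ (Or.inr h2)

/-! ### Boosts -/

/-- The boost in the `(e₁, e₂)`-plane with hyperbolic sine `b`. -/
def boostMat (d : ℕ) (b : ℝ) : Mat d :=
  Matrix.diagonal (fun j : Fin (d + 1) =>
    if (j : ℕ) = 1 ∨ (j : ℕ) = 2 then Real.sqrt (1 + b ^ 2) else 1) + b • hmat d

lemma boostMat_mulVec (d : ℕ) (hd : 3 ≤ d) (b : ℝ) (x : Vd d) (i : Fin (d + 1)) :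
    (boostMat d b).mulVec x i =
      if (i : ℕ) = 1 then Real.sqrt (1 + b ^ 2) * x ⟨1, by omega⟩ + b * x ⟨2, by omega⟩
      else if (i : ℕ) = 2 then Real.sqrt (1 + b ^ 2) * x ⟨2, by omega⟩ + b * x ⟨1, by omega⟩
      else x i := by
  rw [boostMat, Matrix.add_mulVec, Matrix.smul_mulVec, Pi.add_apply, Pi.smul_apply,
    hmat_mulVec d hd, Matrix.mulVec_diagonal]
  by_cases h1 : (i : ℕ) = 1
  · rw [show i = ⟨1, by omega⟩ from Fin.ext h1]; simp
  · by_cases h2 : (i : ℕ) = 2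
    · rw [show i = ⟨2, by omega⟩ from Fin.ext h2]; simp
    · simp [h1, h2]

lemma boostMat_zero (d : ℕ) : boostMat d 0 = 1 := by
  simp [boostMat]

lemma boostMat_mul_neg (d : ℕ) (hd : 3 ≤ d) (b : ℝ) : boostMat d b * boostMat d (-b) = 1 := by
  apply mat_ext_mulVec
  intro x
  have hs : Real.sqrt (1 + b ^ 2) ^ 2 = 1 + b ^ 2 := Real.sq_sqrt (by positivity)
  rw [← Matrix.mulVec_mulVec, Matrix.one_mulVec]
  ext i
  rw [boostMat_mulVec d hd]
  simp only [boostMat_mulVec d hd, neg_sq]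
  by_cases h1 : (i : ℕ) = 1
  · rw [show i = ⟨1, by omega⟩ from Fin.ext h1]
    simp
    linear_combination x ⟨1, by omega⟩ * hs
  · by_cases h2 : (i : ℕ) = 2
    · rw [show i = ⟨2, by omega⟩ from Fin.ext h2]
      simp
      linear_combination x ⟨2, by omega⟩ * hs
    · simp [h1, h2]

lemma boostMat_commute (d : ℕ) (hd : 3 ≤ d) (b : ℝ) :
    boostMat d b * hmat d = hmat d * boostMat d b := by
  apply mat_ext_mulVec
  intro x
  rw [← Matrix.mulVec_mulVec, ← Matrix.mulVec_mulVec]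
  ext i
  simp only [boostMat_mulVec d hd, hmat_mulVec d hd]
  by_cases h1 : (i : ℕ) = 1
  · simp [h1]
  · by_cases h2 : (i : ℕ) = 2
    · simp [h2]
    · simp [h1, h2]

lemma betaB_split (d : ℕ) (hd : 3 ≤ d) (x y : Vd d) :
    betaB d x y = x ⟨1, by omega⟩ * y ⟨1, by omega⟩ - x ⟨2, by omega⟩ * y ⟨2, by omega⟩
      + ∑ j ∈ Finset.univ.filter (fun j : Fin (d + 1) => (j : ℕ) ≠ 1 ∧ (j : ℕ) ≠ 2),
        (if (j : ℕ) ≤ 1 then (1 : ℝ) else -1) * x j * y j := by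
  classical
  unfold betaB
  rw [← Finset.sum_filter_add_sum_filter_not Finset.univ
    (fun j : Fin (d + 1) => (j : ℕ) ≠ 1 ∧ (j : ℕ) ≠ 2), add_comm]
  congr 1
  have : Finset.univ.filter (fun j : Fin (d + 1) => ¬ ((j : ℕ) ≠ 1 ∧ (j : ℕ) ≠ 2))
      = {⟨1, by omega⟩, ⟨2, by omega⟩} := by
    ext j
    simp only [Finset.mem_filter, Finset.mem_univ, true_and, Finset.mem_insert,
      Finset.mem_singleton, Fin.ext_iff]
    omega
  rw [this, Finset.sum_pair (by simp)]
  simp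
  ring

lemma boostMat_mem (d : ℕ) (hd : 3 ≤ d) (b : ℝ) : boostMat d b ∈ ObetaCentralizer d := by
  refine ⟨⟨IsUnit.of_mul_eq_one _ (boostMat_mul_neg d hd b), fun x y => ?_⟩,
    boostMat_commute d hd b⟩
  have hs : Real.sqrt (1 + b ^ 2) ^ 2 = 1 + b ^ 2 := Real.sq_sqrt (by positivity)
  rw [betaB_split d hd, betaB_split d hd x y]
  congr 1
  · simp only [boostMat_mulVec d hd]
    simp
    linear_combination (x ⟨1, by omega⟩ * y ⟨1, by omega⟩ - x ⟨2, by omega⟩ * y ⟨2, by omega⟩) * hs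
  · refine Finset.sum_congr rfl fun j hj => ?_
    obtain ⟨h1, h2⟩ := (Finset.mem_filter.mp hj).2
    simp only [boostMat_mulVec d hd, h1, h2, if_false]

lemma boostMat_mem_component (d : ℕ) (hd : 3 ≤ d) (b : ℝ) :
    boostMat d b ∈ connectedComponentIn (ObetaCentralizer d) 1 := by
  have hc : Continuous (boostMat d) := by
    unfold boostMat
    refine Continuous.add (Continuous.matrix_diagonal ?_) (by fun_prop)
    refine continuous_pi fun j => ?_
    split_ifs <;> fun_prop
  refine (isPreconnected_range hc).subset_connectedComponentIn ⟨0, boostMat_zero d⟩ ?_ ⟨b, rfl⟩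
  rintro _ ⟨c, rfl⟩
  exact boostMat_mem d hd c

/-! ### The identity component -/

lemma det_ne_zero_of_mem_Obeta (d : ℕ) {g : Mat d} (hg : g ∈ Obeta d) : g.det ≠ 0 :=
  ((Matrix.isUnit_iff_isUnit_det g).mp hg.1).ne_zero

lemma continuous_entry (d : ℕ) (i j : Fin (d + 1)) : Continuous fun g : Mat d => g i j := by
  fun_prop

lemma continuous_mat_det (d : ℕ) : Continuous fun g : Mat d => g.det := by
  fun_prop

lemma mem_component_of_pos (d : ℕ) (hd : 3 ≤ d) {g : Mat d} (hg : g ∈ ObetaCentralizer d)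
    (h0 : 0 < g 0 0) (h1 : 0 < g ⟨1, by omega⟩ ⟨1, by omega⟩) (hdet : 0 < g.det) :
    g ∈ connectedComponentIn (ObetaCentralizer d) 1 := by
  set a := g ⟨1, by omega⟩ ⟨1, by omega⟩ with ha
  set b := g ⟨2, by omega⟩ ⟨1, by omega⟩ with hb
  have hmul := @mul_mem_component d _ (mul_mem_ObetaCentralizer d)
  have hsq : a ^ 2 = 1 + b ^ 2 := block_sq d hd hg
  have hs : Real.sqrt (1 + b ^ 2) = a := by rw [← hsq, Real.sqrt_sq h1.le]
  obtain ⟨c1, c2⟩ := block_of_commute d hd hg.2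
  rw [← ha, ← hb] at c1 c2
  set k := boostMat d (-b) * g with hk
  have hkK : k ∈ ObetaCentralizer d :=
    mul_mem_ObetaCentralizer d _ (boostMat_mem d hd _) _ hg
  have hgk : g = boostMat d b * k := by
    rw [hk, ← mul_assoc, boostMat_mul_neg d hd, one_mul]
  have k1 : k.mulVec (evec d ⟨1, by omega⟩) = evec d ⟨1, by omega⟩ := by
    rw [hk, ← Matrix.mulVec_mulVec, c1]
    ext i
    rw [boostMat_mulVec d hd, neg_sq, hs]
    simp only [Pi.add_apply, Pi.smul_apply, smul_eq_mul, evec, Fin.ext_iff]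
    split_ifs <;> first | omega | (simp; try linarith)
  have k2 : k.mulVec (evec d ⟨2, by omega⟩) = evec d ⟨2, by omega⟩ := by
    rw [hk, ← Matrix.mulVec_mulVec, c2]
    ext i
    rw [boostMat_mulVec d hd, neg_sq, hs]
    simp only [Pi.add_apply, Pi.smul_apply, smul_eq_mul, evec, Fin.ext_iff]
    split_ifs <;> first | omega | (simp; try linarith)
  have k0 : 0 < k 0 0 := by
    have : k 0 0 = g 0 0 := by
      have := boostMat_mulVec d hd (-b) (g.mulVec (evec d 0)) 0
      rw [Matrix.mulVec_mulVec, mulVec_evec, mulVec_evec] at this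
      simpa using this
    rwa [this]
  have hbc := boostMat_mem_component d hd b
  rw [hgk]
  rcases inComponentUpToReflection_of_boost_trivial d hd hkK k1 k2 k0 with h | h
  · exact hmul hbc h
  · exfalso
    have hpos : ∀ x ∈ connectedComponentIn (ObetaCentralizer d) 1, 0 < x.det := fun x hx =>
      pos_of_mem_component d _ (continuous_mat_det d)
        (fun y hy => det_ne_zero_of_mem_Obeta d hy.1) (by simp) hx
    have p1 := hpos _ h
    have p2 := hpos _ hbc
    rw [Matrix.det_mul, betaReflection_evec, Matrix.det_diagonal,
      Finset.prod_ite_eq' Finset.univ _ (fun _ => (-1 : ℝ))] at p1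
    rw [hgk, Matrix.det_mul] at hdet
    have p3 := pos_of_mul_pos_right hdet p2.le
    simp at p1
    linarith

lemma minor_ne_zero (d : ℕ) (hd : 3 ≤ d) {g : Mat d} (hg : g ∈ Obeta d) :
    g 0 0 * g ⟨1, by omega⟩ ⟨1, by omega⟩ - g 0 ⟨1, by omega⟩ * g ⟨1, by omega⟩ 0 ≠ 0 := by
  intro h
  have key : ∀ x y : ℝ, g 0 0 * x + g 0 ⟨1, by omega⟩ * y = 0 →
      g ⟨1, by omega⟩ 0 * x + g ⟨1, by omega⟩ ⟨1, by omega⟩ * y = 0 → x = 0 ∧ y = 0 := by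
    intro x y hx hy
    have hb := hg.2 (x • evec d 0 + y • evec d ⟨1, by omega⟩)
      (x • evec d 0 + y • evec d ⟨1, by omega⟩)
    have hle := betaB_self_nonpos d (g.mulVec (x • evec d 0 + y • evec d ⟨1, by omega⟩)) (by
      intro j hj
      rw [Matrix.mulVec_add, Matrix.mulVec_smul, Matrix.mulVec_smul, mulVec_evec, mulVec_evec]
      simp only [Pi.add_apply, Pi.smul_apply, smul_eq_mul]
      have : (j : ℕ) = 0 ∨ (j : ℕ) = 1 := by omega
      rcases this with h | h
      · rw [show j = 0 from Fin.ext h]; linarith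
      · rw [show j = ⟨1, by omega⟩ from Fin.ext h]; linarith)
    rw [hb] at hle
    simp [betaB_add_left, betaB_smul_left, betaB_evec_left, evec, Fin.ext_iff] at hle
    constructor <;> nlinarith
  have r1 := key (g 0 ⟨1, by omega⟩) (-g 0 0) (by ring) (by linarith)
  have r2 := key (g ⟨1, by omega⟩ ⟨1, by omega⟩) (-g ⟨1, by omega⟩ 0) (by linarith) (by ring)
  have r3 := key 1 0 (by linarith [r1.2]) (by linarith [r2.2])
  exact one_ne_zero r3.1

lemma det_pos_of_mem_Gset (d : ℕ) {g : Mat d} (hg : g ∈ Gset d) : 0 < g.det :=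
  pos_of_mem_component d _ (continuous_mat_det d)
    (fun _ hy => det_ne_zero_of_mem_Obeta d hy) (by simp) hg

lemma diagonal_entries_pos_of_mem_Gh (d : ℕ) (hd : 3 ≤ d) {g : Mat d} (hg : g ∈ Gh d) :
    0 < g 0 0 * g ⟨1, by omega⟩ ⟨1, by omega⟩ := by
  have h := pos_of_mem_component d
    (fun g : Mat d => g 0 0 * g ⟨1, by omega⟩ ⟨1, by omega⟩
      - g 0 ⟨1, by omega⟩ * g ⟨1, by omega⟩ 0)
    (by fun_prop) (fun _ hy => minor_ne_zero d hd hy)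
    (by simp [Fin.ext_iff]) hg.1
  simpa [(entries_of_commute d hd hg.2 0 (by simp) (by simp)).1] using h

lemma rmat_mem_Gset (d : ℕ) (hd : 3 ≤ d) : rmat d ∈ Gset d := by
  have key : ∀ i j : Fin (d + 1), i ≠ j → ((i : ℕ) ≤ 1 ↔ (j : ℕ) ≤ 1) →
      betaReflection d (evec d i) * betaReflection d (evec d j) ∈ Gset d := by
    intro i j hij hs
    have hn : ∀ t ∈ Set.Icc (0 : ℝ) 1, betaB d ((1 - t) • evec d i + t • evec d j)
        ((1 - t) • evec d i + t • evec d j) ≠ 0 := by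
      intro t _
      have hp : (1 - t) ^ 2 + t ^ 2 ≠ 0 := by nlinarith [sq_nonneg (1 - 2 * t)]
      simp only [betaB_add_left, betaB_smul_left, betaB_evec_left, Pi.add_apply, Pi.smul_apply,
        smul_eq_mul, evec_apply_self, evec_apply_ne d hij, evec_apply_ne d hij.symm, hs]
      intro h
      apply hp
      split_ifs at h <;> linarith
    exact reflection_mul_reflection_mem_component d (mul_mem_Obeta d) _ _ hn
      fun t ht => betaReflection_mem_Obeta d _ (hn t ht)
  have h01 := key ⟨0, by omega⟩ ⟨1, by omega⟩ (by simp) (by simp)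
  have h23 := key ⟨2, by omega⟩ ⟨3, by omega⟩ (by simp) (by simp)
  have h := mul_mem_component d (mul_mem_Obeta d) h01 h23
  have hr : rmat d =
      betaReflection d (evec d ⟨0, by omega⟩) * betaReflection d (evec d ⟨1, by omega⟩) *
        (betaReflection d (evec d ⟨2, by omega⟩) * betaReflection d (evec d ⟨3, by omega⟩)) := by
    simp only [betaReflection_evec, Matrix.diagonal_mul_diagonal, rmat, Fin.ext_iff]
    congr 1
    ext j
    split_ifs <;> first | omega | norm_num
  rw [hr]
  exact h

lemma rmat_mul_self (d : ℕ) : rmat d * rmat d = 1 := by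
  rw [rmat, Matrix.diagonal_mul_diagonal, ← Matrix.diagonal_one]
  congr 1
  ext j
  split_ifs <;> norm_num

lemma rmat_mem_Gh (d : ℕ) (hd : 3 ≤ d) : rmat d ∈ Gh d := by
  refine ⟨rmat_mem_Gset d hd, ?_⟩
  ext i j
  simp only [rmat, Matrix.mul_diagonal, Matrix.diagonal_mul, hmat, Matrix.of_apply]
  split_ifs <;> first | omega | norm_num

/-- For `d ≥ 3`: `r ∈ G^h`, `r` is not in the identity component `G^h_e`,
and `G^h = G^h_e ∪ r·G^h_e`; so `G^h` has exactly two connected components. -/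
theorem stmt17 (d : ℕ) (hd : 3 ≤ d) :
    rmat d ∈ Gh d ∧
    rmat d ∉ connectedComponentIn (Gh d) 1 ∧
    Gh d = connectedComponentIn (Gh d) 1 ∪
      (fun g => rmat d * g) '' connectedComponentIn (Gh d) 1 := by
  have hr := rmat_mem_Gh d hd
  have hr1 : rmat d ⟨1, by omega⟩ ⟨1, by omega⟩ = -1 := by simp [rmat]
  refine ⟨hr, fun h => ?_, ?_⟩
  · have hpos := pos_of_mem_component d (fun g : Mat d => g ⟨1, by omega⟩ ⟨1, by omega⟩)
      (continuous_entry d _ _)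
      (fun g hg h0 => by
        have := block_sq d hd (Gh_subset_ObetaCentralizer d hg)
        rw [h0] at this
        nlinarith) (by simp) h
    rw [hr1] at hpos
    linarith
  · apply Set.Subset.antisymm
    · intro g hg
      have hgK := Gh_subset_ObetaCentralizer d hg
      have hprod := diagonal_entries_pos_of_mem_Gh d hd hg
      have hdet := det_pos_of_mem_Gset d hg.1
      rcases pos_and_pos_or_neg_and_neg_of_mul_pos hprod with ⟨h0, h1⟩ | ⟨h0, h1⟩
      · exact Or.inl (component_ObetaCentralizer_subset d (mem_component_of_pos d hd hgK h0 h1 hdet))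
      · refine Or.inr ⟨rmat d * g, component_ObetaCentralizer_subset d
          (mem_component_of_pos d hd (mul_mem_ObetaCentralizer d _
            (Gh_subset_ObetaCentralizer d hr) _ hgK) ?_ ?_ ?_), ?_⟩
        · simpa [rmat, Matrix.diagonal_mul] using h0
        · simpa [rmat, Matrix.diagonal_mul] using h1
        · rw [Matrix.det_mul]
          exact mul_pos (det_pos_of_mem_Gset d hr.1) hdet
        · simp only [← mul_assoc, rmat_mul_self, one_mul]
    · rintro g (hg | ⟨k, hk, rfl⟩)
      · exact connectedComponentIn_subset _ _ hg
      · have hkG := connectedComponentIn_subset _ _ hk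
        exact ⟨mul_mem_component d (mul_mem_Obeta d) hr.1 hkG.1,
          (mul_mem_ObetaCentralizer d _ (Gh_subset_ObetaCentralizer d hr) _
            (Gh_subset_ObetaCentralizer d hkG)).2⟩
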